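/- Suppose that Ω is strictly starshaped, i.e. t·cl(Ω) ⊆ Ω for every t ∈ (0,1), and that Φ is strictly increasing. Let (u,E) be a minimal pair in Ω with u ≥ 0 a.e. in ℝⁿ. Then for every open bounded set Ω' ⊆ Ω with Per_σ(Ω', ℝⁿ) < ∞ one has Per_σ(E, Ω') ≤ 2 Per_σ(Ω', ℝⁿ). In particular, there exists C > 0, depending only on n and σ, such that if B_R ⊆ Ω then Per_σ(E, B_r) ≤ C r^{n−σ} for every r ∈ (0, R]. -/

import Mathlib

open MeasureTheory Filter Set Metric Bornology
open scoped ENNReal Topology symmDiff Pointwise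

noncomputable section

abbrev Pt (n : ℕ) : Type := EuclideanSpace ℝ (Fin n)

/-- The interaction functional `L(A,B) = ∫_A ∫_B |x-y|^{-(n+σ)} dy dx`. -/
def interL (n : ℕ) (σ : ℝ) (A B : Set (Pt n)) : ℝ≥0∞ :=
  ∫⁻ x in A, ∫⁻ y in B, ENNReal.ofReal (‖x - y‖ ^ (-((n : ℝ) + σ)))

/-- The fractional `σ`-perimeter of `E` in `D`. -/
def fracPer (n : ℕ) (σ : ℝ) (E D : Set (Pt n)) : ℝ≥0∞ :=
  interL n σ (E ∩ D) Eᶜ + interL n σ (Eᶜ ∩ D) (E ∩ Dᶜ)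

/-- `u` (locally integrable) has weak gradient `G` on the open set `U`. -/
def HasWeakGradOn (n : ℕ) (u : Pt n → ℝ) (G : Pt n → Pt n) (U : Set (Pt n)) : Prop :=
  LocallyIntegrableOn G U volume ∧
  ∀ (i : Fin n) (φ : Pt n → ℝ), ContDiff ℝ (⊤ : ℕ∞) φ → HasCompactSupport φ →
    tsupport φ ⊆ U →
    ∫ x, u x * fderiv ℝ φ x (EuclideanSpace.single i 1) = -∫ x, G x i * φ x

/-- The zero-extension (by `0` outside `Ω`) of `w` has a square-integrable weak
gradient on all of `ℝⁿ`. -/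
def ZeroExtGradL2 (n : ℕ) (Ω : Set (Pt n)) (w : Pt n → ℝ) : Prop :=
  ∃ H : Pt n → Pt n,
    HasWeakGradOn n (Ω.indicator w) H Set.univ ∧
    Integrable (fun x => ‖H x‖ ^ 2) volume

/-- An admissible pair `(u,E)` in `Ω`, with `G` a weak gradient of `u` on `Ω`. -/
structure AdmissiblePair (n : ℕ) (σ : ℝ) (Ω : Set (Pt n)) (u : Pt n → ℝ)
    (G : Pt n → Pt n) (E : Set (Pt n)) : Prop where
  locInt : LocallyIntegrable u volume
  weakGrad : HasWeakGradOn n u G Ω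
  dirichletFin : IntegrableOn (fun x => ‖G x‖ ^ 2) Ω volume
  measE : MeasurableSet E
  perFin : fracPer n σ E Ω ≠ ∞
  nonnegOnE : ∀ᵐ x ∂(volume : Measure (Pt n)), x ∈ E → 0 ≤ u x
  nonposOffE : ∀ᵐ x ∂(volume : Measure (Pt n)), x ∉ E → u x ≤ 0

/-- The energy functional `E_Ω(u,E)` (with `G` the weak gradient of `u` on `Ω`). -/
def energyF (n : ℕ) (σ : ℝ) (Φ : ℝ → ℝ) (Ω : Set (Pt n)) (G : Pt n → Pt n)
    (E : Set (Pt n)) : ℝ :=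
  (∫ x in Ω, ‖G x‖ ^ 2) + Φ ((fracPer n σ E Ω).toReal)

/-- `(u,E)`, with weak gradient `G`, minimizes the energy in `Ω` among admissible
competitors with the same exterior data. -/
def MinimizesIn (n : ℕ) (σ : ℝ) (Φ : ℝ → ℝ) (Ω : Set (Pt n)) (u : Pt n → ℝ)
    (G : Pt n → Pt n) (E : Set (Pt n)) : Prop :=
  AdmissiblePair n σ Ω u G E ∧
  ∀ (v : Pt n → ℝ) (Gv : Pt n → Pt n) (F : Set (Pt n)),
    AdmissiblePair n σ Ω v Gv F →
    (∀ᵐ x ∂(volume : Measure (Pt n)), x ∉ Ω → v x = u x) →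
    ZeroExtGradL2 n Ω (fun x => v x - u x) →
    volume ((F \ Ω) ∆ (E \ Ω)) = 0 →
    energyF n σ Φ Ω G E ≤ energyF n σ Φ Ω Gv F

/-- `(u,E)` is a minimal pair in `Ω`. -/
def IsMinimalPair (n : ℕ) (σ : ℝ) (Φ : ℝ → ℝ) (Ω : Set (Pt n)) (u : Pt n → ℝ)
    (E : Set (Pt n)) : Prop :=
  ∃ G : Pt n → Pt n, MinimizesIn n σ Φ Ω u G E

/-- `ũ(x,y) = xy`. -/
def tildeU : Pt 2 → ℝ := fun p => p 0 * p 1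

/-- `Ẽ = {(x,y) : xy > 0}`. -/
def tildeE : Set (Pt 2) := {p : Pt 2 | 0 < p 0 * p 1}

/-- `∇ũ(x,y) = (y,x)`. -/
def tildeG : Pt 2 → Pt 2 := fun p => (WithLp.equiv 2 (Fin 2 → ℝ)).symm ![p 1, p 0]

/-- The precise representative `û` of a locally integrable function. -/
def preciseRep (n : ℕ) (u : Pt n → ℝ) (x : Pt n) : ℝ :=
  limsup (fun ε : ℝ => (volume (ball x ε)).toReal⁻¹ * ∫ y in ball x ε, u y)
    (𝓝[>] (0 : ℝ))

/-- Membership in the set `𝒰₀`. -/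
def memU0 (n : ℕ) (Ω : Set (Pt n)) (u : Pt n → ℝ) (p : Pt n) : Prop :=
  p ∈ Ω ∧ ∃ xs : ℕ → Pt n, (∀ k, xs k ∈ Ω) ∧ Tendsto xs atTop (𝓝 p) ∧
    Tendsto (fun k => preciseRep n u (xs k)) atTop (𝓝 (0 : ℝ))

end

section InteractionFunctional

variable {n : ℕ} {σ : ℝ}

lemma measurable_rieszKernel :
    Measurable fun p : Pt n × Pt n => ENNReal.ofReal (‖p.1 - p.2‖ ^ (-((n : ℝ) + σ))) := by
  fun_prop

lemma measurable_lintegral_rieszKernel (B : Set (Pt n)) :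
    Measurable fun x : Pt n =>
      ∫⁻ y in B, ENNReal.ofReal (‖x - y‖ ^ (-((n : ℝ) + σ))) :=
  measurable_rieszKernel.lintegral_prod_right'

lemma interL_symm (A B : Set (Pt n)) : interL n σ A B = interL n σ B A := by
  unfold interL
  rw [lintegral_lintegral_swap measurable_rieszKernel.aemeasurable]
  simp_rw [norm_sub_rev]

lemma interL_mono {A A' B B' : Set (Pt n)} (hA : A ⊆ A') (hB : B ⊆ B') :
    interL n σ A B ≤ interL n σ A' B' :=
  (lintegral_mono fun _ => lintegral_mono_set hB).trans (lintegral_mono_set hA)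

lemma interL_union_left {A A' : Set (Pt n)} (B : Set (Pt n)) (hA' : MeasurableSet A')
    (h : Disjoint A A') :
    interL n σ (A ∪ A') B = interL n σ A B + interL n σ A' B :=
  lintegral_union hA' h

lemma interL_union_right (A : Set (Pt n)) {B B' : Set (Pt n)} (hB' : MeasurableSet B')
    (h : Disjoint B B') :
    interL n σ A (B ∪ B') = interL n σ A B + interL n σ A B' := by
  rw [interL_symm, interL_union_left A hB' h, interL_symm B, interL_symm B']

lemma fracPer_univ (E : Set (Pt n)) : fracPer n σ E univ = interL n σ E Eᶜ := by
  simp [fracPer, interL]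

/-- The part of the perimeter of `E` in `D` that does not change when `K` is added to `E`. -/
noncomputable def commonPer (n : ℕ) (σ : ℝ) (E K D : Set (Pt n)) : ℝ≥0∞ :=
  interL n σ (E ∩ D) (E ∪ K)ᶜ + interL n σ ((E ∪ K)ᶜ ∩ D) (E ∩ Dᶜ)

lemma fracPer_eq_commonPer_add {E K D : Set (Pt n)} (hE : MeasurableSet E)
    (hK : MeasurableSet K) (hD : MeasurableSet D) (hKD : K ⊆ D) (hEK : Disjoint E K) :
    fracPer n σ E D = commonPer n σ E K D + interL n σ K E := by
  have hKE : K ⊆ Eᶜ := fun x hx hxE => hEK.le_bot ⟨hxE, hx⟩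
  have h1 : Eᶜ = (E ∪ K)ᶜ ∪ K := by
    ext x
    have := @hKE x
    simp only [mem_compl_iff, mem_union] at *
    tauto
  have h2 : Eᶜ ∩ D = ((E ∪ K)ᶜ ∩ D) ∪ K := by
    ext x
    have := @hKE x
    have := @hKD x
    simp only [mem_compl_iff, mem_union, mem_inter_iff] at *
    tauto
  have hd : Disjoint (E ∪ K)ᶜ K := disjoint_compl_left.mono_right subset_union_right
  have h3 : interL n σ K E = interL n σ K (E ∩ D) + interL n σ K (E ∩ Dᶜ) := by
    rw [← interL_union_right K (hE.inter hD.compl)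
      (disjoint_compl_right.mono inter_subset_right inter_subset_right), inter_union_compl]
  rw [fracPer, h2, interL_union_left _ hK (hd.mono_left inter_subset_left), h3, h1,
    interL_union_right _ hK hd, commonPer, interL_symm K (E ∩ D)]
  abel

lemma fracPer_union_eq_commonPer_add {E K D : Set (Pt n)}
    (hK : MeasurableSet K) (hKD : K ⊆ D) (hEK : Disjoint E K) :
    fracPer n σ (E ∪ K) D = commonPer n σ E K D + interL n σ K (E ∪ K)ᶜ := by
  have h1 : (E ∪ K) ∩ D = (E ∩ D) ∪ K := by
    rw [union_inter_distrib_right, inter_eq_left.2 hKD]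
  have h2 : (E ∪ K) ∩ Dᶜ = E ∩ Dᶜ := by
    rw [union_inter_distrib_right, (disjoint_compl_right.mono_left hKD).inter_eq, union_empty]
  rw [fracPer, h1, h2, interL_union_left _ hK (hEK.mono_left inter_subset_left), commonPer]
  abel

lemma fracPer_le_interL_add {E D : Set (Pt n)} (hE : MeasurableSet E) (hD : MeasurableSet D) :
    fracPer n σ E D ≤ interL n σ (D \ E) E + fracPer n σ D univ := by
  have hK : MeasurableSet (D \ E) := hD.diff hE
  rw [fracPer_eq_commonPer_add hE hK hD sdiff_subset disjoint_sdiff_self_right, add_comm,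
    fracPer_univ]
  have h1 : (E ∪ D \ E)ᶜ ⊆ Dᶜ := by
    rw [union_sdiff_self]
    exact compl_subset_compl.2 subset_union_right
  have h2 : (E ∪ D \ E)ᶜ ∩ D = ∅ := by
    rw [← disjoint_iff_inter_eq_empty]
    exact disjoint_compl_left.mono_left h1
  gcongr
  rw [commonPer, h2]
  simpa [interL] using interL_mono (σ := σ) (inter_subset_right (s := E) (t := D)) h1

end InteractionFunctional

section Ball

variable {n : ℕ} {σ : ℝ}

lemma setLIntegral_eq_smul_preimage {r : ℝ} (hr : 0 < r) {f : Pt n → ℝ≥0∞} (hf : Measurable f)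
    {A : Set (Pt n)} (hA : MeasurableSet A) :
    ∫⁻ x in A, f x =
      ENNReal.ofReal (r ^ n) * ∫⁻ x in (fun x : Pt n => r • x) ⁻¹' A, f (r • x) := by
  have hm := setLIntegral_map (μ := (volume : Measure (Pt n))) hA hf
    (measurable_const_smul r : Measurable fun x : Pt n => r • x)
  rw [← hm, Measure.map_addHaar_smul volume hr.ne', Measure.restrict_smul, lintegral_smul_measure,
    smul_eq_mul, ← mul_assoc, ← ENNReal.ofReal_mul (by positivity), finrank_euclideanSpace_fin,
    abs_of_pos (by positivity), mul_inv_cancel₀ (by positivity), ENNReal.ofReal_one, one_mul]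

lemma interL_eq_smul_preimage {r : ℝ} (hr : 0 < r) {A B : Set (Pt n)} (hA : MeasurableSet A)
    (hB : MeasurableSet B) :
    interL n σ A B = ENNReal.ofReal (r ^ ((n : ℝ) - σ)) *
      interL n σ ((fun x : Pt n => r • x) ⁻¹' A) ((fun x : Pt n => r • x) ⁻¹' B) := by
  have hk (x y : Pt n) : ENNReal.ofReal (‖r • x - r • y‖ ^ (-((n : ℝ) + σ))) =
      ENNReal.ofReal (r ^ (-((n : ℝ) + σ))) * ENNReal.ofReal (‖x - y‖ ^ (-((n : ℝ) + σ))) := by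
    rw [← smul_sub, norm_smul, Real.norm_of_nonneg hr.le,
      Real.mul_rpow hr.le (norm_nonneg _), ENNReal.ofReal_mul (by positivity)]
  have hc : r ^ n * (r ^ n * r ^ (-((n : ℝ) + σ))) = r ^ ((n : ℝ) - σ) := by
    rw [← Real.rpow_natCast, ← Real.rpow_add hr, ← Real.rpow_add hr]
    ring_nf
  unfold interL
  rw [setLIntegral_eq_smul_preimage hr (measurable_lintegral_rieszKernel B) hA]
  have hin (x : Pt n) : ∫⁻ y in B, ENNReal.ofReal (‖r • x - y‖ ^ (-((n : ℝ) + σ))) =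
      ENNReal.ofReal (r ^ n * r ^ (-((n : ℝ) + σ))) *
        ∫⁻ y in (fun x : Pt n => r • x) ⁻¹' B, ENNReal.ofReal (‖x - y‖ ^ (-((n : ℝ) + σ))) := by
    rw [setLIntegral_eq_smul_preimage hr (by fun_prop) hB]
    simp_rw [hk]
    rw [lintegral_const_mul' _ _ ENNReal.ofReal_ne_top, ← mul_assoc,
      ← ENNReal.ofReal_mul (by positivity)]
  simp_rw [hin]
  rw [lintegral_const_mul' _ _ ENNReal.ofReal_ne_top, ← mul_assoc,
    ← ENNReal.ofReal_mul (by positivity), hc]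

lemma fracPer_ball_univ {r : ℝ} (hr : 0 < r) :
    fracPer n σ (ball 0 r) univ =
      ENNReal.ofReal (r ^ ((n : ℝ) - σ)) * fracPer n σ (ball 0 1) univ := by
  have h : (fun x : Pt n => r • x) ⁻¹' ball 0 r = ball 0 1 := by
    ext x
    simp [norm_smul, abs_of_pos hr, hr]
  rw [fracPer_univ, fracPer_univ,
    interL_eq_smul_preimage hr measurableSet_ball measurableSet_ball.compl, preimage_compl, h]

lemma interL_eq_lintegral_translate (A : Set (Pt n)) {B : Set (Pt n)}
    (hB : MeasurableSet B) :
    interL n σ A B = ∫⁻ z : Pt n,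
      ENNReal.ofReal (‖z‖ ^ (-((n : ℝ) + σ))) * volume {x | x ∈ A ∧ x + z ∈ B} := by
  have h1 (x : Pt n) : ∫⁻ y in B, ENNReal.ofReal (‖x - y‖ ^ (-((n : ℝ) + σ))) =
      ∫⁻ z, ENNReal.ofReal (‖z‖ ^ (-((n : ℝ) + σ))) * B.indicator 1 (x + z) := by
    rw [← lintegral_indicator hB, ← lintegral_add_left_eq_self _ x]
    congr with z
    by_cases hz : x + z ∈ B <;> simp [hz]
  unfold interL
  simp_rw [h1]
  rw [lintegral_lintegral_swap]
  · congr with z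
    rw [lintegral_const_mul' _ _ ENNReal.ofReal_ne_top]
    congr 1
    have hm : MeasurableSet ((fun x : Pt n => x + z) ⁻¹' B) := measurable_add_const z hB
    change ∫⁻ x in A, ((fun x : Pt n => x + z) ⁻¹' B).indicator 1 x = _
    rw [lintegral_indicator_one hm, Measure.restrict_apply hm, inter_comm]
    rfl
  · refine Measurable.aemeasurable (Measurable.mul (by fun_prop) ?_)
    exact (measurable_one.indicator hB).comp (measurable_fst.add measurable_snd)

lemma volume_ball_inter_translate_compl_le [NeZero n] (z : Pt n) :
    volume {x : Pt n | x ∈ ball (0 : Pt n) 1 ∧ x + z ∈ (ball (0 : Pt n) 1)ᶜ} ≤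
      ENNReal.ofReal (min 1 (n * ‖z‖)) * volume (ball (0 : Pt n) 1) := by
  rcases le_total 1 (n * ‖z‖) with h | h
  · rw [min_eq_left h, ENNReal.ofReal_one, one_mul]
    exact measure_mono fun x hx => hx.1
  · have hn : (1 : ℝ) ≤ n := by exact_mod_cast NeZero.one_le
    have hz : ‖z‖ ≤ 1 := by nlinarith [norm_nonneg z]
    have hsub : {x : Pt n | x ∈ ball (0 : Pt n) 1 ∧ x + z ∈ (ball (0 : Pt n) 1)ᶜ} ⊆
        ball 0 1 \ ball 0 (1 - ‖z‖) := by
      rintro x ⟨hx1, hx2⟩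
      refine ⟨hx1, fun hx3 => hx2 ?_⟩
      rw [mem_ball_zero_iff] at hx3 ⊢
      linarith [norm_add_le x z]
    have hpow : 1 - n * ‖z‖ ≤ (1 - ‖z‖) ^ n := by
      have := one_add_mul_le_pow (a := -‖z‖) (by linarith) n
      simpa [sub_eq_add_neg] using this
    refine (measure_mono hsub).trans ?_
    rw [measure_sdiff (ball_subset_ball (by linarith [norm_nonneg z]))
      measurableSet_ball.nullMeasurableSet measure_ball_lt_top.ne, min_eq_right h,
      Measure.addHaar_ball volume (0 : Pt n) (sub_nonneg.2 hz), finrank_euclideanSpace_fin,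
      tsub_le_iff_right, ← add_mul, ← ENNReal.ofReal_add (by positivity) (by positivity)]
    refine le_mul_of_one_le_left' ?_
    rw [ENNReal.one_le_ofReal]
    linarith

lemma integrable_norm_rpow_mul_min [NeZero n] (hσ : σ ∈ Ioo (0 : ℝ) 1) :
    Integrable (fun z : Pt n => ‖z‖ ^ (-((n : ℝ) + σ)) * min 1 (n * ‖z‖)) := by
  have hn : 1 ≤ n := NeZero.one_le
  rw [integrable_fun_norm_addHaar volume
    (f := fun s : ℝ => s ^ (-((n : ℝ) + σ)) * min 1 (n * s)), finrank_euclideanSpace_fin]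
  have hmeas : Measurable fun y : ℝ =>
      y ^ (n - 1) • (y ^ (-((n : ℝ) + σ)) * min 1 (n * y)) := by fun_prop
  have hpow {y : ℝ} (hy : 0 < y) :
      y ^ (n - 1) * y ^ (-((n : ℝ) + σ)) = y ^ (-1 - σ) := by
    rw [← Real.rpow_natCast, ← Real.rpow_add hy, Nat.cast_sub hn]
    congr 1
    push_cast
    ring
  have hnn {y : ℝ} (hy : 0 < y) :
      ‖y ^ (n - 1) • (y ^ (-((n : ℝ) + σ)) * min 1 (n * y))‖ =
        y ^ (-1 - σ) * min 1 (n * y) := by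
    rw [smul_eq_mul, ← mul_assoc, hpow hy, Real.norm_of_nonneg (by positivity)]
  rw [← Ioc_union_Ioi_eq_Ioi (zero_le_one (α := ℝ))]
  refine IntegrableOn.union ?_ ?_
  · have hint : IntegrableOn (fun y : ℝ => n * y ^ (-σ)) (Ioc 0 1) := by
      rw [← intervalIntegrable_iff_integrableOn_Ioc_of_le zero_le_one]
      exact (intervalIntegral.intervalIntegrable_rpow' (by linarith [hσ.2])).const_mul _
    refine hint.mono' hmeas.aestronglyMeasurable ?_
    filter_upwards [ae_restrict_mem measurableSet_Ioc] with y hy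
    rw [hnn hy.1]
    calc y ^ (-1 - σ) * min 1 (n * y) ≤ y ^ (-1 - σ) * (n * y) := by
          have := Real.rpow_nonneg hy.1.le (-1 - σ)
          gcongr
          exact min_le_right _ _
      _ = n * (y ^ (-1 - σ) * y ^ (1 : ℝ)) := by rw [Real.rpow_one]; ring
      _ = n * y ^ (-σ) := by rw [← Real.rpow_add hy.1]; ring_nf
  · refine (integrableOn_Ioi_rpow_of_lt (a := -1 - σ) (by linarith [hσ.1]) zero_lt_one).mono'
      hmeas.aestronglyMeasurable ?_
    filter_upwards [ae_restrict_mem measurableSet_Ioi] with y hy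
    have hy0 : 0 < y := zero_lt_one.trans hy
    rw [hnn hy0]
    exact mul_le_of_le_one_right (by positivity) (min_le_left _ _)

lemma fracPer_unit_ball_ne_top [NeZero n] (hσ : σ ∈ Ioo (0 : ℝ) 1) :
    fracPer n σ (ball (0 : Pt n) 1) univ ≠ ∞ := by
  rw [fracPer_univ, interL_eq_lintegral_translate _ measurableSet_ball.compl]
  refine ne_top_of_le_ne_top ?_ (lintegral_mono fun z =>
    mul_le_mul_right (volume_ball_inter_translate_compl_le z) _)
  simp_rw [← mul_assoc]
  rw [lintegral_mul_const' _ _ measure_ball_lt_top.ne]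
  refine ENNReal.mul_ne_top ?_ measure_ball_lt_top.ne
  have h := (integrable_norm_rpow_mul_min (n := n) hσ).lintegral_lt_top
  refine ne_of_eq_of_ne (lintegral_congr fun z => ?_) h.ne
  rw [ENNReal.ofReal_mul (by positivity)]

end Ball

lemma hasWeakGradOn_zero (n : ℕ) (U : Set (Pt n)) : HasWeakGradOn n 0 0 U :=
  ⟨(locallyIntegrable_const 0).locallyIntegrableOn _, by simp⟩

/-- Adding `D` to the positivity set of a minimal pair with `0 ≤ u` does not decrease the
perimeter. -/
lemma IsMinimalPair.interL_sdiff_le {n : ℕ} {σ : ℝ} {Φ : ℝ → ℝ} {Ω E D : Set (Pt n)}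
    {u : Pt n → ℝ} (hΩ : MeasurableSet Ω) (hΦ : StrictMonoOn Φ (Ici 0))
    (hmin : IsMinimalPair n σ Φ Ω u E)
    (hu : ∀ᵐ x ∂(volume : Measure (Pt n)), 0 ≤ u x) (hD : MeasurableSet D) (hDΩ : D ⊆ Ω)
    (hper : fracPer n σ D univ ≠ ∞) :
    interL n σ (D \ E) E ≤ fracPer n σ D univ := by
  obtain ⟨G, hadm, hle⟩ := hmin
  have hK : MeasurableSet (D \ E) := hD.diff hadm.measE
  have hKΩ : D \ E ⊆ Ω := sdiff_subset.trans hDΩ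
  have hd : Disjoint E (D \ E) := disjoint_sdiff_self_right
  have hE := fracPer_eq_commonPer_add (σ := σ) hadm.measE hK hΩ hKΩ hd
  have hF := fracPer_union_eq_commonPer_add (σ := σ) hK hKΩ hd
  have hKF : interL n σ (D \ E) (E ∪ D \ E)ᶜ ≤ fracPer n σ D univ := by
    rw [fracPer_univ, union_sdiff_self]
    exact interL_mono sdiff_subset (compl_subset_compl.2 subset_union_right)
  have hcommon : commonPer n σ E (D \ E) Ω ≠ ∞ :=
    ne_top_of_le_ne_top hadm.perFin (hE ▸ le_self_add)
  have hFfin : fracPer n σ (E ∪ D \ E) Ω ≠ ∞ :=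
    hF ▸ ENNReal.add_ne_top.2 ⟨hcommon, ne_top_of_le_ne_top hper hKF⟩
  have hFadm : AdmissiblePair n σ Ω u G (E ∪ D \ E) :=
    { hadm with
      measE := hadm.measE.union hK
      perFin := hFfin
      nonnegOnE := hu.mono fun _ hx _ => hx
      nonposOffE := hadm.nonposOffE.mono fun _ hx hxF => hx fun hxE => hxF (Or.inl hxE) }
  have hext : (E ∪ D \ E) \ Ω = E \ Ω := by
    rw [union_sdiff_distrib, sdiff_eq_bot_iff.2 hKΩ]
    simp
  have henergy := hle u G (E ∪ D \ E) hFadm (Eventually.of_forall fun _ _ => rfl)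
    ⟨0, by simpa [← Pi.zero_def] using hasWeakGradOn_zero n univ, by simp⟩
    (by rw [hext, symmDiff_self, bot_eq_empty, measure_empty])
  have hΦle := (add_le_add_iff_left _).1 henergy
  rw [hΦ.le_iff_le ENNReal.toReal_nonneg ENNReal.toReal_nonneg,
    ENNReal.toReal_le_toReal hadm.perFin hFfin, hE, hF] at hΦle
  exact ((ENNReal.add_le_add_iff_left hcommon).1 hΦle).trans hKF

/-- uniform perimeter bounds for minimal pairs (Lemma 2.7). -/
theorem statement12 (n : ℕ) (hn : 1 ≤ n) (σ : ℝ) (hσ : σ ∈ Set.Ioo (0 : ℝ) 1) :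
    ∃ C : ℝ, 0 < C ∧
      ∀ (Ω : Set (Pt n)) (Φ : ℝ → ℝ) (u : Pt n → ℝ) (E : Set (Pt n)),
        IsOpen Ω → IsBounded Ω →
        (∀ t ∈ Set.Ioo (0 : ℝ) 1, t • closure Ω ⊆ Ω) →
        StrictMonoOn Φ (Set.Ici 0) →
        IsMinimalPair n σ Φ Ω u E →
        (∀ᵐ x ∂(volume : Measure (Pt n)), 0 ≤ u x) →
        (∀ Ω' : Set (Pt n), IsOpen Ω' → IsBounded Ω' → Ω' ⊆ Ω →
          fracPer n σ Ω' Set.univ ≠ ∞ →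
          fracPer n σ E Ω' ≤ 2 * fracPer n σ Ω' Set.univ) ∧
        (∀ R r : ℝ, ball (0 : Pt n) R ⊆ Ω → r ∈ Set.Ioc (0 : ℝ) R →
          fracPer n σ E (ball (0 : Pt n) r) ≤ ENNReal.ofReal (C * r ^ ((n : ℝ) - σ))) := by
  have : NeZero n := ⟨by omega⟩
  have hfin : fracPer n σ (ball (0 : Pt n) 1) univ ≠ ∞ := fracPer_unit_ball_ne_top hσ
  refine ⟨2 * (fracPer n σ (ball (0 : Pt n) 1) univ).toReal + 1, by positivity, ?_⟩
  intro Ω Φ u E hΩ _ _ hΦ hmin hu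
  have hmain (D : Set (Pt n)) (hD : IsOpen D) (hDΩ : D ⊆ Ω) (hper : fracPer n σ D univ ≠ ∞) :
      fracPer n σ E D ≤ 2 * fracPer n σ D univ := by
    have hE : MeasurableSet E := let ⟨_, h⟩ := hmin; h.1.measE
    rw [two_mul]
    exact (fracPer_le_interL_add hE hD.measurableSet).trans (add_le_add_left
      (hmin.interL_sdiff_le hΩ.measurableSet hΦ hu hD.measurableSet hDΩ hper) _)
  refine ⟨fun D hD _ hDΩ hper => hmain D hD hDΩ hper, fun R r hR hr => ?_⟩
  have hball := fracPer_ball_univ (n := n) (σ := σ) hr.1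
  refine (hmain _ isOpen_ball ((ball_subset_ball hr.2).trans hR)
    (hball ▸ ENNReal.mul_ne_top ENNReal.ofReal_ne_top hfin)).trans ?_
  have hpow : 0 ≤ r ^ ((n : ℝ) - σ) := Real.rpow_nonneg hr.1.le _
  rw [hball, ENNReal.ofReal_mul (by positivity), mul_left_comm, mul_comm]
  gcongr
  rw [ENNReal.ofReal_add (by positivity) zero_le_one, ENNReal.ofReal_mul zero_le_two,
    ENNReal.ofReal_toReal hfin]
  simp
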